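/- In a multi-unit auction with unit demand, for every integer k with 0 ≤ k ≤ n and k − m odd, no non-deficit Groves mechanism collectively dominates the OEL mechanism with index k. -/

import Mathlib

/-!
STATEMENT 12: Multi-unit auction with unit demand: n+1 ≥ 2 agents, m units
with 1 ≤ m ≤ n, types in [L,U] with 0 ≤ L < U. For every integer k with
0 ≤ k ≤ n+1 and k − m odd (equivalently k + m odd), no non-deficit Groves
mechanism collectively dominates the OEL mechanism with index k.

Encoding: `kthTop x j` is the (j+1)-th highest coordinate of x (0-based j),
so the paper's [x]_j is `kthTop x (j-1)`; the total VCG payment is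
m·[θ]_{m+1} = m·kthTop θ m. `oelCoeff N m k L U i` is the paper's
coefficient c_i for an auction with N agents, and the OEL redistribution of
the paper, r(x) = c₀ + Σ_{j=1}^{N−1} c_j [x]_j, is `oelR`. A Groves mechanism
is a family r : Fin (n+1) → ([L,U]^n → ℝ) and θ_{-i} = θ ∘ i.succAbove;
non-deficit means Σ_i r_i(θ_{-i}) ≤ m·[θ]_{m+1} on the box [L,U]^{n+1}.
-/

/-- The (j+1)-th highest coordinate of the tuple `x` (`j` 0-based). -/
noncomputable def kthTop {N : ℕ} (x : Fin N → ℝ) (j : Fin N) : ℝ :=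
  x (Tuple.sort x j.rev)

/-- (−1)^{m−i}·C(N−i−1, N−m−1)/C(m−1, i−1), for 1 ≤ i ≤ m. -/
noncomputable def oelA (N m i : ℕ) : ℝ :=
  (-1 : ℝ) ^ (m - i) * ((N - i - 1).choose (N - m - 1) : ℝ) /
    ((m - 1).choose (i - 1) : ℝ)

/-- (−1)^{m−i−1}·C(i−1, m−1)/C(N−m−1, N−i−1), for m+1 ≤ i ≤ N−1
(the parity of m−i−1 equals that of i−m−1, which is used since i > m). -/
noncomputable def oelB (N m i : ℕ) : ℝ :=
  (-1 : ℝ) ^ (i - m - 1) * ((i - 1).choose (m - 1) : ℝ) /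
    ((N - m - 1).choose (N - i - 1) : ℝ)

/-- The OEL coefficients c_0, …, c_{N−1} for index k, with N agents. -/
noncomputable def oelCoeff (N m k : ℕ) (L U : ℝ) : ℕ → ℝ := fun i =>
  if k = 0 then
    if i = 0 then U * m / N - U * ∑ j ∈ Finset.Icc 1 m, oelA N m j
    else if i ≤ m then oelA N m i
    else 0
  else if k ≤ m then
    if i = k then (m : ℝ) / N - ∑ j ∈ Finset.Icc (k+1) m, oelA N m j
    else if k + 1 ≤ i ∧ i ≤ m then oelA N m i
    else 0
  else if k ≤ N - 1 then
    if i = k then (m : ℝ) / N - ∑ j ∈ Finset.Icc (m+1) (k-1), oelB N m j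
    else if m + 1 ≤ i ∧ i ≤ k - 1 then oelB N m i
    else 0
  else
    if i = 0 then L * m / N - L * ∑ j ∈ Finset.Icc (m+1) (N-1), oelB N m j
    else if m + 1 ≤ i ∧ i ≤ N - 1 then oelB N m i
    else 0

/-- The OEL redistribution function (for one of the n+1 agents, as a function
of the n types of the others): r(x) = c₀ + Σ_{j=1}^{n} c_j·[x]_j. -/
noncomputable def oelR (n m k : ℕ) (L U : ℝ) (x : Fin n → ℝ) : ℝ :=
  oelCoeff (n+1) m k L U 0 +
    ∑ j : Fin n, oelCoeff (n+1) m k L U (j.1 + 1) * kthTop x j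

/-! ### Permutations and deleting a coordinate -/

/-- The permutation sending `j` to `p.1` and acting as `p.2` on the rest. -/
def permOf {n : ℕ} (j : Fin (n+1)) (p : Fin (n+1) × Equiv.Perm (Fin n)) :
    Equiv.Perm (Fin (n+1)) :=
  ((finSuccEquiv' j).trans (Equiv.optionCongr p.2)).trans (finSuccEquiv' p.1).symm

theorem permOf_self {n : ℕ} (j : Fin (n+1)) (p : Fin (n+1) × Equiv.Perm (Fin n)) :
    permOf j p j = p.1 := by
  simp [permOf]

theorem permOf_succAbove {n : ℕ} (j : Fin (n+1)) (p : Fin (n+1) × Equiv.Perm (Fin n))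
    (l : Fin n) : permOf j p (j.succAbove l) = p.1.succAbove (p.2 l) := by
  simp [permOf]

theorem permOf_bijective {n : ℕ} (j : Fin (n+1)) : Function.Bijective (permOf j) := by
  rw [Fintype.bijective_iff_injective_and_card]
  constructor
  · rintro ⟨i, σ⟩ ⟨i', σ'⟩ h
    have h1 : i = i' := by
      have := congrArg (fun e : Equiv.Perm (Fin (n+1)) => e j) h
      simpa [permOf_self] using this
    subst h1
    have h2 : σ = σ' := by
      ext l
      have := congrArg (fun e : Equiv.Perm (Fin (n+1)) => e (j.succAbove l)) h
      simp only [permOf_succAbove] at this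
      exact congrArg Fin.val (Fin.succAbove_right_injective this)
    rw [h2]
  · simp [Fintype.card_perm, Nat.factorial_succ]

theorem perm_succAbove {n : ℕ} (π : Equiv.Perm (Fin (n+1))) (i : Fin (n+1)) :
    ∃ σ : Equiv.Perm (Fin n), ∀ l, π (i.succAbove l) = (π i).succAbove (σ l) := by
  obtain ⟨⟨i', σ⟩, rfl⟩ := (permOf_bijective i).2 π
  exact ⟨σ, fun l => by rw [permOf_succAbove, permOf_self]⟩

/-- The symmetrization of a family of functions. -/
noncomputable def symF {n : ℕ} (d : Fin (n+1) → (Fin n → ℝ) → ℝ) (x : Fin n → ℝ) : ℝ :=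
  ∑ j, ∑ σ : Equiv.Perm (Fin n), d j (x ∘ σ)

theorem symF_perm {n : ℕ} (d : Fin (n+1) → (Fin n → ℝ) → ℝ) (x : Fin n → ℝ)
    (τ : Equiv.Perm (Fin n)) : symF d (x ∘ τ) = symF d x := by
  unfold symF
  refine Finset.sum_congr rfl fun j _ => ?_
  refine Fintype.sum_equiv (Equiv.mulLeft τ) _ _ fun σ => ?_
  rfl

theorem sum_symF {n : ℕ} (d : Fin (n+1) → (Fin n → ℝ) → ℝ) (θ : Fin (n+1) → ℝ) :
    ∑ i : Fin (n+1), symF d (θ ∘ i.succAbove) =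
      ∑ π : Equiv.Perm (Fin (n+1)), ∑ j : Fin (n+1), d j ((θ ∘ π) ∘ j.succAbove) := by
  unfold symF
  rw [Finset.sum_comm, Finset.sum_comm (s := (Finset.univ : Finset (Equiv.Perm (Fin (n+1)))))]
  refine Finset.sum_congr rfl fun j _ => ?_
  rw [← Fintype.sum_prod_type']
  refine Fintype.sum_bijective (permOf j) (permOf_bijective j) _ _ fun p => ?_
  congr 1
  funext l
  simp [permOf_succAbove]

theorem sum_cons {n : ℕ} (d : Fin (n+1) → (Fin n → ℝ) → ℝ) (v : ℝ) (x : Fin n → ℝ) :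
    ∑ i : Fin (n+1), symF d ((Fin.cons v x : Fin (n+1) → ℝ) ∘ i.succAbove) =
      symF d x + ∑ i : Fin n, symF d (Function.update x i v) := by
  rw [Fin.sum_univ_succ]
  congr 1
  refine Finset.sum_congr rfl fun i _ => ?_
  obtain ⟨σ, hσ⟩ := perm_succAbove (Equiv.swap (0 : Fin (n+1)) i.succ) i.succ
  rw [← symF_perm d (Function.update x i v) σ]
  congr 1
  funext l
  have h1 : i.succ.succAbove l = Equiv.swap (0 : Fin (n+1)) i.succ ((σ l).succ) := by
    have := hσ l
    rw [Equiv.swap_apply_right, Fin.succAbove_zero] at this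
    rw [← this, Equiv.swap_apply_self]
  simp only [Function.comp_apply, h1]
  by_cases h : σ l = i
  · rw [h]; simp
  · rw [Equiv.swap_apply_of_ne_of_ne (Fin.succ_ne_zero _) (by simpa using h)]
    simp [Function.update_of_ne h]

/-- The induction at the heart of the argument. -/
theorem symF_zero {n : ℕ} (d : Fin (n+1) → (Fin n → ℝ) → ℝ) (v : ℝ)
    (P : (Fin n → ℝ) → Prop)
    (hP : ∀ x i, P x → x i ≠ v → P (Function.update x i v))
    (h0 : ∀ x, P x → ∑ i : Fin (n+1),
      symF d ((Fin.cons v x : Fin (n+1) → ℝ) ∘ i.succAbove) = 0) :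
    ∀ (b : ℕ) (x : Fin n → ℝ), P x →
      (Finset.univ.filter fun i => x i ≠ v).card = b → symF d x = 0 := by
  intro b
  induction b using Nat.strong_induction_on with
  | _ b ih =>
    intro x hx hb
    have h := h0 x hx
    rw [sum_cons] at h
    have h2 : ∀ i : Fin n, symF d (Function.update x i v) =
        if x i = v then symF d x else 0 := by
      intro i
      split_ifs with hi
      · rw [← hi, Function.update_eq_self]
      · refine ih _ ?_ _ (hP x i hx hi) rfl
        rw [← hb]
        apply Finset.card_lt_card
        rw [Finset.ssubset_iff_of_subset]
        · exact ⟨i, by simpa using hi, by simp⟩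
        · intro l
          simp only [Finset.mem_filter, Finset.mem_univ, true_and]
          intro hl
          by_cases hli : l = i
          · subst hli; exact hi
          · rwa [Function.update_of_ne hli] at hl
    simp only [h2] at h
    rw [← Finset.sum_filter, Finset.sum_const, nsmul_eq_mul] at h
    have h3 : (1 + ((Finset.univ.filter fun i => x i = v).card : ℝ)) * symF d x = 0 := by
      linarith
    rcases mul_eq_zero.1 h3 with h4 | h4
    · have : (0 : ℝ) ≤ ((Finset.univ.filter fun i => x i = v).card : ℝ) := Nat.cast_nonneg _
      linarith
    · exact h4

/-! ### Order statistics -/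

theorem kthTop_perm {N : ℕ} (x : Fin N → ℝ) (σ : Equiv.Perm (Fin N)) (j : Fin N) :
    kthTop (x ∘ σ) j = kthTop x j := by
  have := congrFun (Tuple.comp_perm_comp_sort_eq_comp_sort (f := x) (σ := σ)) j.rev
  simpa [kthTop] using this

theorem kthTop_of_antitone {N : ℕ} (x : Fin N → ℝ) (hx : Antitone x) (j : Fin N) :
    kthTop x j = x j := by
  have hmono : Monotone (x ∘ (Fin.revPerm : Equiv.Perm (Fin N))) := by
    intro a b hab
    apply hx
    simpa using hab
  have := congrFun ((Tuple.comp_sort_eq_comp_iff_monotone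
    (f := x) (σ := (Fin.revPerm : Equiv.Perm (Fin N)))).2 hmono) j.rev
  simp only [Function.comp_apply, Fin.revPerm_apply, Fin.rev_rev] at this
  exact this.symm

theorem exists_sorted {N : ℕ} (x : Fin N → ℝ) :
    ∃ σ : Equiv.Perm (Fin N), Antitone (x ∘ σ) := by
  refine ⟨(Fin.revPerm : Equiv.Perm (Fin N)).trans (Tuple.sort x), ?_⟩
  intro a b hab
  have := Tuple.monotone_sort x (Fin.rev_le_rev.2 hab)
  simpa using this

theorem card_perm {N : ℕ} (x : Fin N → ℝ) (σ : Equiv.Perm (Fin N)) (p : ℝ → Prop)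
    [DecidablePred p] :
    (Finset.univ.filter fun i => p ((x ∘ σ) i)).card =
      (Finset.univ.filter fun i => p (x i)).card := by
  simp only [Finset.card_filter, Function.comp_apply]
  exact Equiv.sum_comp σ (fun i => if p (x i) then 1 else 0)

theorem kthTop_count {N : ℕ} (x : Fin N → ℝ) (j : Fin N) :
    (Finset.univ.filter fun i => kthTop x j < x i).card ≤ j.1 ∧
      j.1 < (Finset.univ.filter fun i => kthTop x j ≤ x i).card := by
  obtain ⟨σ, hσ⟩ := exists_sorted x
  rw [← kthTop_perm x σ, ← card_perm x σ (fun y => kthTop (x ∘ σ) j < y),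
    ← card_perm x σ (fun y => kthTop (x ∘ σ) j ≤ y), kthTop_of_antitone _ hσ]
  constructor
  · calc _ ≤ (Finset.Iio j).card := by
          apply Finset.card_le_card
          intro i
          simp only [Finset.mem_filter, Finset.mem_univ, true_and, Finset.mem_Iio]
          intro h
          by_contra h'
          exact absurd (hσ (not_lt.1 h')) (not_le.2 h)
      _ = j.1 := by simp
  · calc j.1 < (Finset.Iic j).card := by simp
      _ ≤ _ := by
          apply Finset.card_le_card
          intro i
          simp only [Finset.mem_filter, Finset.mem_univ, true_and, Finset.mem_Iic]
          intro h
          exact hσ h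

theorem kthTop_eq {N : ℕ} (x : Fin N → ℝ) (j : Fin N) (v : ℝ)
    (h1 : (Finset.univ.filter fun i => v < x i).card ≤ j.1)
    (h2 : j.1 < (Finset.univ.filter fun i => v ≤ x i).card) : kthTop x j = v := by
  obtain ⟨h3, h4⟩ := kthTop_count x j
  rcases lt_trichotomy (kthTop x j) v with h | h | h
  · have : (Finset.univ.filter fun i => v ≤ x i).card ≤
        (Finset.univ.filter fun i => kthTop x j < x i).card := by
      apply Finset.card_le_card
      intro i
      simp only [Finset.mem_filter, Finset.mem_univ, true_and]
      intro h'; linarith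
    omega
  · exact h
  · have : (Finset.univ.filter fun i => kthTop x j ≤ x i).card ≤
        (Finset.univ.filter fun i => v < x i).card := by
      apply Finset.card_le_card
      intro i
      simp only [Finset.mem_filter, Finset.mem_univ, true_and]
      intro h'; linarith
    omega

theorem card_cons {n : ℕ} (v : ℝ) (x : Fin n → ℝ) (p : ℝ → Prop) [DecidablePred p] :
    (Finset.univ.filter fun i => p ((Fin.cons v x : Fin (n+1) → ℝ) i)).card =
      (if p v then 1 else 0) + (Finset.univ.filter fun i => p (x i)).card := by
  simp only [Finset.card_filter]
  rw [Fin.sum_univ_succ]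
  simp

theorem sum_kthTop {n : ℕ} (θ : Fin (n+1) → ℝ) (j : Fin n) :
    ∑ i : Fin (n+1), kthTop (θ ∘ i.succAbove) j =
      (j.1 + 1 : ℝ) * kthTop θ j.succ + (n - j.1 : ℝ) * kthTop θ j.castSucc := by
  obtain ⟨σ, hσ⟩ := exists_sorted θ
  have hinv : ∑ i : Fin (n+1), kthTop (θ ∘ i.succAbove) j =
      ∑ i : Fin (n+1), kthTop ((θ ∘ σ) ∘ i.succAbove) j := by
    symm
    refine Fintype.sum_equiv σ _ _ fun i => ?_
    obtain ⟨τ, hτ⟩ := perm_succAbove σ i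
    rw [← kthTop_perm (θ ∘ (σ i).succAbove) τ]
    congr 1
    funext l
    simp [hτ]
  rw [hinv, ← kthTop_perm θ σ j.succ, ← kthTop_perm θ σ j.castSucc,
    kthTop_of_antitone _ hσ, kthTop_of_antitone _ hσ]
  generalize θ ∘ σ = φ at hσ
  have h1 : ∀ i : Fin (n+1), kthTop (φ ∘ i.succAbove) j =
      if i ≤ j.castSucc then φ j.succ else φ j.castSucc := by
    intro i
    rw [kthTop_of_antitone _ (hσ.comp_monotone (Fin.strictMono_succAbove i).monotone)]
    simp only [Function.comp_apply]
    split_ifs with h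
    · rw [Fin.succAbove_of_le_castSucc _ _ h]
    · rw [Fin.succAbove_of_castSucc_lt _ _ (not_le.1 h)]
  simp only [h1]
  rw [Finset.sum_ite, Finset.sum_const, Finset.sum_const, nsmul_eq_mul, nsmul_eq_mul]
  have e1 : (Finset.univ.filter fun i : Fin (n+1) => i ≤ j.castSucc).card = j.1 + 1 := by
    have : (Finset.univ.filter fun i : Fin (n+1) => i ≤ j.castSucc) =
        Finset.Iic j.castSucc := by ext; simp
    rw [this]; simp
  have e2 : (Finset.univ.filter fun i : Fin (n+1) => ¬ i ≤ j.castSucc).card = n - j.1 := by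
    have : (Finset.univ.filter fun i : Fin (n+1) => ¬ i ≤ j.castSucc) =
        Finset.Ioi j.castSucc := by ext; simp
    rw [this]; simp
  rw [e1, e2, Nat.cast_sub j.2.le]
  push_cast
  ring

/-- Total OEL redistribution in terms of the order statistics. -/
theorem sum_oelR {n m k : ℕ} {L U : ℝ} (θ : Fin (n+1) → ℝ) (s : ℕ → ℝ)
    (hs : ∀ j : Fin (n+1), s j.1 = kthTop θ j) :
    ∑ i : Fin (n+1), oelR n m k L U (θ ∘ i.succAbove) =
      (n + 1 : ℝ) * oelCoeff (n+1) m k L U 0 + ∑ i ∈ Finset.Icc 1 n,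
        oelCoeff (n+1) m k L U i * (i * s i + ((n + 1 : ℝ) - i) * s (i - 1)) := by
  unfold oelR
  rw [Finset.sum_add_distrib, Finset.sum_comm]
  congr 1
  · simp
  · have h1 : Finset.Icc 1 n = Finset.Ico (0 + 1) (n + 1) := by
      ext i; simp only [Finset.mem_Icc, Finset.mem_Ico]; omega
    rw [h1, ← Finset.sum_Ico_add', ← Finset.range_eq_Ico, ← Fin.sum_univ_eq_sum_range
      (fun i => oelCoeff (n+1) m k L U (i+1) *
        (((i + 1 : ℕ) : ℝ) * s (i+1) + ((n + 1 : ℝ) - ((i + 1 : ℕ) : ℝ)) * s (i + 1 - 1)))]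
    refine Finset.sum_congr rfl fun j _ => ?_
    rw [← Finset.mul_sum, sum_kthTop, ← hs, ← hs]
    simp only [Fin.val_succ, Fin.val_castSucc]
    rw [Nat.add_sub_cancel]
    push_cast
    ring

/-! ### Coefficient identities -/

theorem oelA_last {N m : ℕ} : oelA N m m = 1 := by
  simp [oelA]

theorem oelA_rec {N m i : ℕ} (hi : 1 ≤ i) (him : i < m) (hmN : m < N) :
    (i : ℝ) * oelA N m i + ((N : ℝ) - (i + 1)) * oelA N m (i+1) = 0 := by
  obtain ⟨i, rfl⟩ : ∃ t, i = t + 1 := ⟨i - 1, by omega⟩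
  obtain ⟨q, rfl⟩ : ∃ q, m = i + 2 + q := ⟨m - (i + 2), by omega⟩
  obtain ⟨p, rfl⟩ : ∃ p, N = i + 2 + q + 1 + p := ⟨N - (i + 2 + q + 1), by omega⟩
  unfold oelA
  rw [show i + 2 + q - (i + 1) = q + 1 by omega, show i + 2 + q - (i + 1 + 1) = q by omega,
    show i + 2 + q + 1 + p - (i + 1) - 1 = q + p + 1 by omega,
    show i + 2 + q + 1 + p - (i + 1 + 1) - 1 = q + p by omega,
    show i + 2 + q + 1 + p - (i + 2 + q) - 1 = p by omega,
    show i + 2 + q - 1 = i + 1 + q by omega, show i + 1 - 1 = i by omega,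
    show i + 1 + 1 - 1 = i + 1 by omega]
  have h1 : (((q + p + 1).choose p : ℕ) : ℝ) * (q + 1) = ((q + p).choose p : ℕ) * (q + p + 1) := by
    have := Nat.choose_mul_succ_eq (q + p) p
    rw [show q + p + 1 - p = q + 1 by omega] at this
    exact_mod_cast this.symm
  have h2 : (((i + 1 + q).choose (i + 1) : ℕ) : ℝ) * (i + 1) =
      ((i + 1 + q).choose i : ℕ) * (q + 1) := by
    have := Nat.choose_succ_right_eq (i + 1 + q) i
    rw [show i + 1 + q - i = q + 1 by omega] at this
    exact_mod_cast this
  have p1 : (((i + 1 + q).choose (i + 1) : ℕ) : ℝ) ≠ 0 :=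
    Nat.cast_ne_zero.2 (Nat.choose_pos (by omega)).ne'
  have p2 : (((i + 1 + q).choose i : ℕ) : ℝ) ≠ 0 :=
    Nat.cast_ne_zero.2 (Nat.choose_pos (by omega)).ne'
  have p3 : (q + 1 : ℝ) ≠ 0 := by positivity
  push_cast
  rw [pow_succ]
  generalize (((q + p + 1).choose p : ℕ) : ℝ) = a at *
  generalize (((q + p).choose p : ℕ) : ℝ) = b at *
  generalize (((i + 1 + q).choose (i + 1) : ℕ) : ℝ) = c at *
  generalize (((i + 1 + q).choose i : ℕ) : ℝ) = e at *
  have h3 : (i + 1) * (a / e) = (q + p + 1) * (b / c) := by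
    field_simp
    apply mul_right_cancel₀ p3
    linear_combination (i + 1 : ℝ) * c * h1 + b * (q + p + 1) * h2
  linear_combination (-1 : ℝ) ^ q * (-1) * h3

theorem oelB_first {N m : ℕ} (hm : 1 ≤ m) (hmN : m + 1 < N) :
    ((N : ℝ) - (m + 1)) * oelB N m (m+1) = m := by
  obtain ⟨m, rfl⟩ : ∃ t, m = t + 1 := ⟨m - 1, by omega⟩
  obtain ⟨p, rfl⟩ : ∃ p, N = m + 1 + 1 + 1 + p := ⟨N - (m + 3), by omega⟩
  unfold oelB
  rw [show m + 1 + 1 - (m + 1) - 1 = 0 by omega,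
    show m + 1 + 1 + 1 + p - (m + 1) - 1 = p + 1 by omega,
    show m + 1 + 1 + 1 + p - (m + 1 + 1) - 1 = p by omega]
  simp only [Nat.add_sub_cancel, Nat.choose_succ_self_right]
  have : (p + 1 : ℝ) ≠ 0 := by positivity
  push_cast
  field_simp
  ring

theorem oelB_rec {N m i : ℕ} (hm : 1 ≤ m) (hi : m + 1 ≤ i) (hiN : i + 1 < N) :
    (i : ℝ) * oelB N m i + ((N : ℝ) - (i + 1)) * oelB N m (i+1) = 0 := by
  obtain ⟨m, rfl⟩ : ∃ t, m = t + 1 := ⟨m - 1, by omega⟩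
  obtain ⟨q, rfl⟩ : ∃ q, i = m + 2 + q := ⟨i - (m + 2), by omega⟩
  obtain ⟨p, rfl⟩ : ∃ p, N = m + 2 + q + 2 + p := ⟨N - (m + 2 + q + 2), by omega⟩
  unfold oelB
  rw [show m + 2 + q - (m + 1) - 1 = q by omega,
    show m + 2 + q + 1 - (m + 1) - 1 = q + 1 by omega,
    show m + 2 + q - 1 = m + 1 + q by omega,
    show m + 2 + q + 1 - 1 = m + 1 + q + 1 by omega,
    show m + 1 - 1 = m by omega,
    show m + 2 + q + 2 + p - (m + 1) - 1 = q + p + 2 by omega,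
    show m + 2 + q + 2 + p - (m + 2 + q) - 1 = p + 1 by omega,
    show m + 2 + q + 2 + p - (m + 2 + q + 1) - 1 = p by omega]
  have h1 : (((m + 1 + q + 1).choose m : ℕ) : ℝ) * (q + 2) =
      ((m + 1 + q).choose m : ℕ) * (m + 1 + q + 1) := by
    have := Nat.choose_mul_succ_eq (m + 1 + q) m
    rw [show m + 1 + q + 1 - m = q + 2 by omega] at this
    exact_mod_cast this.symm
  have h2 : (((q + p + 2).choose (p + 1) : ℕ) : ℝ) * (p + 1) =
      ((q + p + 2).choose p : ℕ) * (q + 2) := by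
    have := Nat.choose_succ_right_eq (q + p + 2) p
    rw [show q + p + 2 - p = q + 2 by omega] at this
    exact_mod_cast this
  have p1 : (((q + p + 2).choose (p + 1) : ℕ) : ℝ) ≠ 0 :=
    Nat.cast_ne_zero.2 (Nat.choose_pos (by omega)).ne'
  have p2 : (((q + p + 2).choose p : ℕ) : ℝ) ≠ 0 :=
    Nat.cast_ne_zero.2 (Nat.choose_pos (by omega)).ne'
  have p3 : (q + 2 : ℝ) ≠ 0 := by positivity
  push_cast
  rw [pow_succ]
  generalize (((m + 1 + q + 1).choose m : ℕ) : ℝ) = a at *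
  generalize (((m + 1 + q).choose m : ℕ) : ℝ) = b at *
  generalize (((q + p + 2).choose (p + 1) : ℕ) : ℝ) = c at *
  generalize (((q + p + 2).choose p : ℕ) : ℝ) = e at *
  have h3 : (m + 2 + q) * (b / c) = (p + 1) * (a / e) := by
    field_simp
    apply mul_right_cancel₀ p3
    linear_combination (-(p + 1 : ℝ)) * c * h1 - b * (m + 2 + q) * h2
  linear_combination (-1 : ℝ) ^ q * h3

theorem sumA {N m : ℕ} (hmN : m < N) : ∀ t k : ℕ, k + t + 1 = m → ∀ s : ℕ → ℝ,
    ∑ i ∈ Finset.Icc (k+1) m, oelA N m i * (i * s i + ((N : ℝ) - i) * s (i - 1)) =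
      m * s m + ((N : ℝ) - (k + 1)) * oelA N m (k+1) * s k := by
  intro t
  induction t with
  | zero =>
    intro k hk s
    have : m = k + 1 := by omega
    subst this
    simp [oelA_last]
  | succ t ih =>
    intro k hk s
    rw [← Finset.insert_Icc_succ_left_eq_Icc (show k + 1 ≤ m by omega),
      Finset.sum_insert (by simp)]
    rw [Order.succ_eq_add_one, ih (k+1) (by omega) s]
    have h := oelA_rec (N := N) (m := m) (i := k+1) (by omega) (by omega) hmN
    simp only [Nat.add_sub_cancel]
    push_cast at h ⊢
    linear_combination s (k+1) * h

theorem sumB {N m : ℕ} (hm : 1 ≤ m) : ∀ t : ℕ, m + 1 + t < N → ∀ s : ℕ → ℝ,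
    ∑ i ∈ Finset.Icc (m+1) (m+1+t), oelB N m i * (i * s i + ((N : ℝ) - i) * s (i - 1)) =
      m * s m + ((m + 1 + t : ℕ) : ℝ) * oelB N m (m+1+t) * s (m+1+t) := by
  intro t
  induction t with
  | zero =>
    intro h s
    have h1 := oelB_first (N := N) (m := m) hm (by omega)
    simp only [add_zero, Finset.Icc_self, Finset.sum_singleton, Nat.add_sub_cancel]
    push_cast
    linear_combination s m * h1
  | succ t ih =>
    intro h s
    rw [← add_assoc, Finset.sum_Icc_succ_top (by omega), ih (by omega) s]
    have h1 := oelB_rec (N := N) (m := m) (i := m+1+t) (by omega) (by omega) (by omega)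
    simp only [Nat.add_sub_cancel]
    push_cast at h1 ⊢
    linear_combination s (m+1+t) * h1

theorem exA {N m k : ℕ} (hmN : m < N) (hk : k ≤ m) : ∃ K : ℝ, ∀ s : ℕ → ℝ,
    ∑ i ∈ Finset.Icc (k+1) m, oelA N m i * (i * s i + ((N : ℝ) - i) * s (i - 1)) =
      m * s m + K * s k := by
  rcases hk.eq_or_lt with h | h
  · subst h
    exact ⟨-k, fun s => by simp⟩
  · exact ⟨_, sumA hmN (m - k - 1) k (by omega)⟩

theorem exB {N m k : ℕ} (hm : 1 ≤ m) (hk : m < k) (hkN : k ≤ N) : ∃ K : ℝ, ∀ s : ℕ → ℝ,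
    ∑ i ∈ Finset.Icc (m+1) (k-1), oelB N m i * (i * s i + ((N : ℝ) - i) * s (i - 1)) =
      m * s m + K * s (k - 1) := by
  rcases (show k = m + 1 ∨ m + 1 < k by omega) with h | h
  · subst h
    exact ⟨-m, fun s => by simp⟩
  · obtain ⟨t, rfl⟩ : ∃ t, k = m + 1 + t + 1 := ⟨k - (m + 2), by omega⟩
    exact ⟨_, sumB hm t (by omega)⟩

theorem sum_restrict {n : ℕ} (c e g : ℕ → ℝ) (a b : ℕ) (ha : 1 ≤ a) (hb : b ≤ n)
    (h : ∀ i ∈ Finset.Icc 1 n, c i = if a ≤ i ∧ i ≤ b then e i else 0) :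
    ∑ i ∈ Finset.Icc 1 n, c i * g i = ∑ i ∈ Finset.Icc a b, e i * g i := by
  have : Finset.Icc a b = (Finset.Icc 1 n).filter fun i => a ≤ i ∧ i ≤ b := by
    ext i; simp; omega
  rw [this, Finset.sum_filter]
  refine Finset.sum_congr rfl fun i hi => ?_
  rw [h i hi]
  split_ifs <;> simp

theorem sum_restrict' {n : ℕ} (c e g : ℕ → ℝ) (a b k : ℕ) (ha : 1 ≤ a) (hb : b ≤ n)
    (hk : 1 ≤ k) (hkn : k ≤ n) (hkab : ¬ (a ≤ k ∧ k ≤ b)) (C : ℝ)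
    (h : ∀ i ∈ Finset.Icc 1 n, c i = if i = k then C else if a ≤ i ∧ i ≤ b then e i else 0) :
    ∑ i ∈ Finset.Icc 1 n, c i * g i = C * g k + ∑ i ∈ Finset.Icc a b, e i * g i := by
  have h1 := sum_restrict (fun i => c i - if i = k then C else 0) e g a b ha hb (by
    intro i hi
    simp only [h i hi]
    split_ifs with h1 h2 h2
    · subst h1; exact absurd h2 hkab
    · simp
    · simp
    · simp)
  rw [← h1]
  simp only [sub_mul, Finset.sum_sub_distrib, ite_mul, zero_mul]
  rw [Finset.sum_ite_eq' (Finset.Icc 1 n) k]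
  simp [hk, hkn]

/-- Budget balance of the OEL mechanism. -/
theorem balanced {n m k : ℕ} (hm : 1 ≤ m) (hmn : m ≤ n) {L U : ℝ} (hk : k ≤ n + 1)
    (s : ℕ → ℝ) (h0 : k = 0 → s 0 = U) (h1 : 1 ≤ k → k ≤ n → s (k - 1) = s k)
    (h2 : k = n + 1 → s n = L) :
    (n + 1 : ℝ) * oelCoeff (n+1) m k L U 0 + ∑ i ∈ Finset.Icc 1 n,
        oelCoeff (n+1) m k L U i * (i * s i + ((n + 1 : ℝ) - i) * s (i - 1)) = m * s m := by
  have hN : (n + 1 : ℝ) ≠ 0 := by positivity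
  by_cases hk0 : k = 0
  · subst hk0
    obtain ⟨K, hK⟩ := exA (N := n+1) (m := m) (k := 0) (by omega) (by omega)
    have hs := hK s
    have ho := hK (fun _ => 1)
    have e0 : oelCoeff (n+1) m 0 L U 0 =
        U * m / (n+1 : ℕ) - U * ∑ j ∈ Finset.Icc 1 m, oelA (n+1) m j := by
      simp [oelCoeff]
    rw [e0, sum_restrict _ (oelA (n+1) m) _ 1 m le_rfl hmn (by
      intro i hi
      rw [Finset.mem_Icc] at hi
      have : i ≠ 0 := by omega
      have h1i : 1 ≤ i := hi.1
      simp [oelCoeff, this, h1i])]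
    rw [h0 rfl] at hs
    push_cast at hs ho ⊢
    rw [hs]
    have ho' : (n + 1 : ℝ) * ∑ j ∈ Finset.Icc 1 m, oelA (n+1) m j = m + K := by
      rw [Finset.mul_sum]
      rw [← mul_one (m : ℝ), ← mul_one K, ← ho]
      refine Finset.sum_congr rfl fun i _ => by ring
    field_simp
    linear_combination (-U) * ho'
  by_cases hkm : k ≤ m
  · obtain ⟨K, hK⟩ := exA (N := n+1) (m := m) (k := k) (by omega) hkm
    have hs := hK s
    have ho := hK (fun _ => 1)
    have e0 : oelCoeff (n+1) m k L U 0 = 0 := by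
      simp [oelCoeff, hk0, hkm]; intro h; omega
    rw [e0, sum_restrict' _ (oelA (n+1) m) _ (k+1) m k (by omega) hmn (by omega) (by omega)
      (by omega) ((m : ℝ) / (n+1 : ℕ) - ∑ j ∈ Finset.Icc (k+1) m, oelA (n+1) m j) (by
      intro i hi
      simp only [oelCoeff, hk0, hkm, if_true, if_false])]
    push_cast at hs ho ⊢
    rw [hs, h1 (by omega) (by omega)]
    have ho' : (n + 1 : ℝ) * ∑ j ∈ Finset.Icc (k+1) m, oelA (n+1) m j = m + K := by
      rw [Finset.mul_sum]
      rw [← mul_one (m : ℝ), ← mul_one K, ← ho]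
      refine Finset.sum_congr rfl fun i _ => by ring
    field_simp
    linear_combination (-s k) * (n + 1 : ℝ) * ho'
  obtain ⟨K, hK⟩ := exB (N := n+1) (m := m) (k := k) hm (by omega) hk
  have hs := hK s
  have ho := hK (fun _ => 1)
  have ho' : (n + 1 : ℝ) * ∑ j ∈ Finset.Icc (m+1) (k-1), oelB (n+1) m j = m + K := by
    push_cast at ho
    rw [Finset.mul_sum]
    rw [← mul_one (m : ℝ), ← mul_one K, ← ho]
    refine Finset.sum_congr rfl fun i _ => by ring
  by_cases hkn : k ≤ n
  · have e0 : oelCoeff (n+1) m k L U 0 = 0 := by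
      simp [oelCoeff, hk0, hkm, hkn]; intro h; omega
    rw [e0, sum_restrict' _ (oelB (n+1) m) _ (m+1) (k-1) k (by omega) (by omega) (by omega)
      (by omega) (by omega)
      ((m : ℝ) / (n+1 : ℕ) - ∑ j ∈ Finset.Icc (m+1) (k-1), oelB (n+1) m j) (by
      intro i hi
      simp only [oelCoeff, hk0, hkm, Nat.add_sub_cancel, hkn, if_true, if_false])]
    push_cast at hs ho ⊢
    rw [hs, h1 (by omega) (by omega)]
    field_simp
    linear_combination (-s k) * (n + 1 : ℝ) * ho'
  · have hkk : k = n + 1 := by omega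
    subst hkk
    have e0 : oelCoeff (n+1) m (n+1) L U 0 =
        L * m / (n+1 : ℕ) - L * ∑ j ∈ Finset.Icc (m+1) n, oelB (n+1) m j := by
      simp [oelCoeff, hkm]
    rw [e0, sum_restrict _ (oelB (n+1) m) _ (m+1) n (by omega) le_rfl (by
      intro i hi
      rw [Finset.mem_Icc] at hi
      have : i ≠ 0 := by omega
      simp [oelCoeff, hkm, this])]
    simp only [Nat.add_sub_cancel] at hs ho'
    rw [h2 rfl] at hs
    push_cast at hs ⊢
    rw [hs]
    field_simp
    linear_combination (-L) * ho'

theorem oel_balanced {n m k : ℕ} (hm : 1 ≤ m) (hmn : m ≤ n) {L U : ℝ} (hk : k ≤ n + 1)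
    (θ : Fin (n+1) → ℝ) (v : ℝ) (h0 : k = 0 → v = U) (h2 : k = n + 1 → v = L)
    (h : ∀ j : Fin (n+1), (j.1 = k ∨ j.1 + 1 = k) → kthTop θ j = v) :
    ∑ i : Fin (n+1), oelR n m k L U (θ ∘ i.succAbove) = m * kthTop θ ⟨m, by omega⟩ := by
  let s : ℕ → ℝ := fun j => if hj : j < n + 1 then kthTop θ ⟨j, hj⟩ else 0
  have hs : ∀ j : Fin (n+1), s j.1 = kthTop θ j := fun j => dif_pos j.2
  have hs' : ∀ j, j < n + 1 → (j = k ∨ j + 1 = k) → s j = v := by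
    intro j hj hjk
    rw [← h ⟨j, hj⟩ hjk, ← hs]
  rw [sum_oelR θ s hs, balanced hm hmn hk s, ← hs]
  · intro hk0; rw [← h0 hk0]; exact hs' 0 (by omega) (by omega)
  · intro a b; rw [hs' (k-1) (by omega) (by omega), hs' k (by omega) (by omega)]
  · intro a; rw [← h2 a]; exact hs' n (by omega) (by omega)

theorem stmt_12 {n m : ℕ} (hn : 1 ≤ n) (hm : 1 ≤ m) (hmn : m ≤ n)
    {L U : ℝ} (hL : 0 ≤ L) (hLU : L < U)
    (k : ℕ) (hk : k ≤ n + 1) (hodd : Odd (k + m)) :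
    ¬ ∃ r : Fin (n+1) → (Fin n → ℝ) → ℝ,
      -- r is non-deficit
      (∀ θ : Fin (n+1) → ℝ, (∀ i, θ i ∈ Set.Icc L U) →
        ∑ i : Fin (n+1), r i (θ ∘ i.succAbove) ≤
          m * kthTop θ ⟨m, by omega⟩) ∧
      -- r collectively dominates the OEL mechanism with index k
      (∀ θ : Fin (n+1) → ℝ, (∀ i, θ i ∈ Set.Icc L U) →
        ∑ i : Fin (n+1), oelR n m k L U (θ ∘ i.succAbove) ≤
          ∑ i : Fin (n+1), r i (θ ∘ i.succAbove)) ∧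
      (∃ θ : Fin (n+1) → ℝ, (∀ i, θ i ∈ Set.Icc L U) ∧
        ∑ i : Fin (n+1), oelR n m k L U (θ ∘ i.succAbove) <
          ∑ i : Fin (n+1), r i (θ ∘ i.succAbove)) := by
  rintro ⟨r, hnd, hdom, θ₀, hθ₀, hlt⟩
  set d : Fin (n+1) → (Fin n → ℝ) → ℝ := fun i x => r i x - oelR n m k L U x with hd
  have hD : ∀ θ : Fin (n+1) → ℝ, ∑ j : Fin (n+1), d j (θ ∘ j.succAbove) =
      ∑ i : Fin (n+1), r i (θ ∘ i.succAbove) -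
        ∑ i : Fin (n+1), oelR n m k L U (θ ∘ i.succAbove) := by
    intro θ; simp [hd, Finset.sum_sub_distrib]
  -- the symmetrized difference vanishes at balanced profiles
  have hbal : ∀ (θ : Fin (n+1) → ℝ) (v : ℝ), (∀ i, θ i ∈ Set.Icc L U) →
      (k = 0 → v = U) → (k = n + 1 → v = L) →
      (∀ j : Fin (n+1), (j.1 = k ∨ j.1 + 1 = k) → kthTop θ j = v) →
      ∑ i : Fin (n+1), symF d (θ ∘ i.succAbove) = 0 := by
    intro θ v hθ h0 h2 h
    rw [sum_symF]
    refine Finset.sum_eq_zero fun π _ => ?_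
    have hb : ∀ i, (θ ∘ π) i ∈ Set.Icc L U := fun i => hθ (π i)
    have e := oel_balanced (n := n) (m := m) (k := k) hm hmn (L := L) (U := U) hk (θ ∘ π) v h0 h2
      (fun j hj => by rw [kthTop_perm]; exact h j hj)
    have a1 := hnd _ hb
    have a2 := hdom _ hb
    rw [hD]
    linarith
  have hzero : ∀ x : Fin n → ℝ, (∀ i, x i ∈ Set.Icc L U) → symF d x = 0 := by
    intro x hx
    obtain ⟨v, hv, h0, h2, h3⟩ : ∃ v ∈ Set.Icc L U, (k = 0 → v = U) ∧ (k = n + 1 → v = L) ∧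
        (1 ≤ k → k ≤ n → (Finset.univ.filter fun i => v < x i).card < k ∧
          k ≤ (Finset.univ.filter fun i => v ≤ x i).card) := by
      rcases (show k = 0 ∨ k = n + 1 ∨ (1 ≤ k ∧ k ≤ n) by omega) with h | h | h
      · exact ⟨U, ⟨hLU.le, le_rfl⟩, fun _ => rfl, by omega, by omega⟩
      · exact ⟨L, ⟨le_rfl, hLU.le⟩, by omega, fun _ => rfl, by omega⟩
      · refine ⟨kthTop x ⟨k - 1, by omega⟩, hx _, by omega, by omega, fun _ _ => ?_⟩
        have := kthTop_count x ⟨k - 1, by omega⟩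
        simp only at this
        omega
    refine symF_zero d v (fun x => (∀ i, x i ∈ Set.Icc L U) ∧
      (1 ≤ k → k ≤ n → (Finset.univ.filter fun i => v < x i).card < k ∧
          k ≤ (Finset.univ.filter fun i => v ≤ x i).card)) ?_ ?_ _ x ⟨hx, h3⟩ rfl
    · rintro x i ⟨hx, hc⟩ hne
      refine ⟨fun l => ?_, fun a b => ?_⟩
      · by_cases hl : l = i
        · subst hl; simpa using hv
        · rw [Function.update_of_ne hl]; exact hx l
      · obtain ⟨c1, c2⟩ := hc a b
        constructor
        · refine lt_of_le_of_lt (Finset.card_le_card ?_) c1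
          intro l
          simp only [Finset.mem_filter, Finset.mem_univ, true_and]
          by_cases hl : l = i
          · subst hl; simp
          · rw [Function.update_of_ne hl]; exact id
        · refine le_trans c2 (Finset.card_le_card ?_)
          intro l
          simp only [Finset.mem_filter, Finset.mem_univ, true_and]
          by_cases hl : l = i
          · subst hl; simp
          · rw [Function.update_of_ne hl]; exact id
    · rintro x ⟨hx, hc⟩
      refine hbal _ v ?_ h0 h2 ?_
      · intro i
        refine Fin.cases ?_ (fun l => ?_) i
        · simpa using hv
        · simpa using hx l
      · intro j hj
        apply kthTop_eq
        · rw [card_cons v x (fun y => v < y)]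
          simp only [lt_irrefl, if_false, zero_add]
          rcases (show k = 0 ∨ k = n + 1 ∨ (1 ≤ k ∧ k ≤ n) by omega) with h | h | h
          · have : (Finset.univ.filter fun i => v < x i) = ∅ := by
              rw [h0 h]
              ext i
              simpa using (hx i).2
            simp [this]
          · have : (Finset.univ.filter fun i => v < x i).card ≤ n := by
              simpa using Finset.card_le_univ (Finset.univ.filter fun i => v < x i)
            have := j.2
            omega
          · have := hc h.1 h.2
            omega
        · rw [card_cons v x (fun y => v ≤ y)]
          simp only [le_refl, if_true]
          rcases (show k = 0 ∨ k = n + 1 ∨ (1 ≤ k ∧ k ≤ n) by omega) with h | h | h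
          · omega
          · have : (Finset.univ.filter fun i => v ≤ x i) = Finset.univ := by
              rw [h2 h]
              ext i
              simpa using (hx i).1
            simp only [this, Finset.card_univ, Fintype.card_fin]
            have := j.2
            omega
          · have := hc h.1 h.2
            omega
  have hsum : ∑ i : Fin (n+1), symF d (θ₀ ∘ i.succAbove) = 0 :=
    Finset.sum_eq_zero fun i _ => hzero _ fun l => hθ₀ _
  rw [sum_symF] at hsum
  have hnn : ∀ π ∈ (Finset.univ : Finset (Equiv.Perm (Fin (n+1)))),
      0 ≤ ∑ j : Fin (n+1), d j ((θ₀ ∘ π) ∘ j.succAbove) := by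
    intro π _
    rw [hD]
    have := hdom (θ₀ ∘ π) (fun i => hθ₀ (π i))
    linarith
  have h1 := (Finset.sum_eq_zero_iff_of_nonneg hnn).1 hsum 1 (Finset.mem_univ _)
  simp only [Equiv.Perm.coe_one, Function.comp_id] at h1
  rw [hD] at h1
  linarith
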